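/- Let 1 ≤ d ≤ n be integers and let E ⊆ ℝ^n be either compact, or bounded and open, with H^d(E) > 0. Let f : E → [0,∞) be continuous and let 1 < p < ∞. Then (1/H^d_∞(E)) ∫_E f dH^d_∞ ≤ C ((1/H^d_∞(E)) ∫_E f^p dH^d_∞)^{1/p}, where C is a constant depending only on n and the integrals are Choquet integrals with respect to Hausdorff content. -/

import Mathlib

open MeasureTheory Metric Set
open scoped ENNReal NNReal

noncomputable section

variable {n : ℕ}
/-- `d`-dimensional Hausdorff content. -/
def hContent (d : ℕ) {X : Type*} [PseudoEMetricSpace X] (A : Set X) : ℝ≥0∞ :=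
  ⨅ (t : ℕ → Set X) (_ : A ⊆ ⋃ i, t i), ∑' i, EMetric.diam (t i) ^ d

/-- The Choquet integral `∫_A f^p dH^d_∞ = ∫_0^∞ H^d_∞({x ∈ A : f(x) > t}) t^{p-1} dt`. -/
def choquetIntegral {X : Type*} [PseudoEMetricSpace X] [MeasurableSpace X]
    (d : ℕ) (A : Set X) (f : X → ℝ) (p : ℝ) : ℝ≥0∞ :=
  ∫⁻ t in Set.Ioi (0:ℝ), hContent d {x | x ∈ A ∧ t < f x} * ENNReal.ofReal (t ^ (p - 1))

theorem hContent_mono (d : ℕ) {X : Type*} [PseudoEMetricSpace X] {A B : Set X} (h : A ⊆ B) :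
    hContent d A ≤ hContent d B :=
  iInf_mono fun _ => iInf_mono' fun ht => ⟨h.trans ht, le_rfl⟩

/-- Jensen's inequality, up to a factor `2`, for the layer-cake integrals of a distribution function
`h ≤ 1`. -/
theorem lintegral_le_two_mul_lintegral_rpow {h : ℝ → ℝ≥0∞} (h_le : ∀ t, h t ≤ 1) {p : ℝ}
    (hp : 1 < p) :
    ∫⁻ t in Ioi (0 : ℝ), h t ≤
      2 * (∫⁻ t in Ioi (0 : ℝ), h t * ENNReal.ofReal (t ^ (p - 1))) ^ (1 / p) := by
  have hp0 : 0 < p := by linarith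
  rw [mul_comm, ← ENNReal.div_le_iff (by simp) (by simp)]
  refine ENNReal.le_of_forall_nnreal_lt fun a ha => ?_
  rcases eq_or_ne a 0 with rfl | ha0
  · simp
  have ha_pos : (0 : ℝ) < a := by positivity
  rw [one_div, ENNReal.le_rpow_inv_iff hp0]
  have tail : (a : ℝ≥0∞) ≤ ∫⁻ t in Ioi (a : ℝ), h t := by
    have split : ∫⁻ t in Ioi (0 : ℝ), h t ≤ a + ∫⁻ t in Ioi (a : ℝ), h t := by
      rw [← Ioc_union_Ioi_eq_Ioi ha_pos.le]
      refine (lintegral_union_le _ _ _).trans (add_le_add ?_ le_rfl)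
      calc ∫⁻ t in Ioc (0 : ℝ) a, h t ≤ ∫⁻ _ in Ioc (0 : ℝ) a, 1 := lintegral_mono h_le
        _ = a := by simp
    have double : (a : ℝ≥0∞) + a ≤ ∫⁻ t in Ioi (0 : ℝ), h t := by
      rw [← mul_two]
      exact (ENNReal.le_div_iff_mul_le (by simp) (by simp)).1 ha.le
    exact (ENNReal.add_le_add_iff_left ENNReal.coe_ne_top).1 (double.trans split)
  calc (a : ℝ≥0∞) ^ p = a * ENNReal.ofReal ((a : ℝ) ^ (p - 1)) := by
        rw [← ENNReal.ofReal_rpow_of_pos ha_pos, ENNReal.ofReal_coe_nnreal]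
        nth_rewrite 2 [← ENNReal.rpow_one (a : ℝ≥0∞)]
        rw [← ENNReal.rpow_add _ _ (by simpa using ha0) ENNReal.coe_ne_top]
        congr 1
        ring
    _ ≤ (∫⁻ t in Ioi (a : ℝ), h t) * ENNReal.ofReal ((a : ℝ) ^ (p - 1)) := by gcongr
    _ = ∫⁻ t in Ioi (a : ℝ), h t * ENNReal.ofReal ((a : ℝ) ^ (p - 1)) :=
        (lintegral_mul_const' _ _ ENNReal.ofReal_ne_top).symm
    _ ≤ ∫⁻ t in Ioi (a : ℝ), h t * ENNReal.ofReal (t ^ (p - 1)) := by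
        refine setLIntegral_mono' measurableSet_Ioi fun t ht => ?_
        have hat : (a : ℝ) ≤ t := le_of_lt ht
        gcongr
    _ ≤ ∫⁻ t in Ioi (0 : ℝ), h t * ENNReal.ofReal (t ^ (p - 1)) :=
        lintegral_mono_set (Ioi_subset_Ioi ha_pos.le)

/-- **Lemma (Jensen's inequality for Choquet integration).** For `E ⊆ ℝ^n` compact, or bounded
and open, with `H^d(E) > 0`, a continuous `f ≥ 0` on `E` and `1 < p < ∞`,
`(1/H^d_∞(E)) ∫_E f dH^d_∞ ≲_n ((1/H^d_∞(E)) ∫_E f^p dH^d_∞)^{1/p}`. -/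
theorem choquet_jensen (n : ℕ) :
    ∃ C : ℝ, 0 < C ∧
      ∀ d : ℕ, 1 ≤ d → d ≤ n →
        ∀ E : Set (EuclideanSpace ℝ (Fin n)),
          (IsCompact E ∨ (Bornology.IsBounded E ∧ IsOpen E)) →
          0 < μH[(d:ℝ)] E →
          ∀ f : EuclideanSpace ℝ (Fin n) → ℝ, ContinuousOn f E → (∀ x ∈ E, 0 ≤ f x) →
            ∀ p : ℝ, 1 < p →
              (hContent d E)⁻¹ * choquetIntegral d E f 1 ≤
                ENNReal.ofReal C *
                  ((hContent d E)⁻¹ * choquetIntegral d E f p) ^ (1 / p) := by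
  refine ⟨2, two_pos, fun d _ _ E _ _ f _ _ p hp => ?_⟩
  have level_le (t : ℝ) : hContent d {x | x ∈ E ∧ t < f x} ≤ hContent d E :=
    hContent_mono d fun _ hx => hx.1
  rcases eq_or_ne (hContent d E) 0 with hE | hE
  · have hzero (t : ℝ) : hContent d {x | x ∈ E ∧ t < f x} = 0 :=
      le_antisymm ((level_le t).trans_eq hE) zero_le
    simp [choquetIntegral, hzero]
  have hinv : (hContent d E)⁻¹ ≠ ∞ := ENNReal.inv_ne_top.2 hE
  have key := lintegral_le_two_mul_lintegral_rpow
    (h := fun t => (hContent d E)⁻¹ * hContent d {x | x ∈ E ∧ t < f x})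
    (fun t => (mul_le_mul_right (level_le t) _).trans (ENNReal.inv_mul_le_one _)) hp
  simp only [mul_assoc] at key
  rw [lintegral_const_mul' _ _ hinv, lintegral_const_mul' _ _ hinv] at key
  simpa [choquetIntegral] using key
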